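/- For d ≥ 3, c, t, λ > 0 and p ≥ 1, the p-th moment of the distance process R_d^{2,j} satisfies E[(R_d^{2,j})^p] = ( (ct)^p / E_{d/2−1, d/2}(λt) ) · [ (Γ((p+d)/2)/Γ(d/2)) · λt · E_{d/2−1, d+p/2−1}(λt) + 1/Γ(d/2) ]. Equivalently, with g as defined in the context, ∫_0^{ct} r^p g(r) dr + (ct)^p / ( E_{d/2−1, d/2}(λt) Γ(d/2) ) = ( (ct)^p / E_{d/2−1, d/2}(λt) ) · [ (Γ((p+d)/2)/Γ(d/2)) · λt · E_{d/2−1, d+p/2−1}(λt) + 1/Γ(d/2) ]. -/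

import Mathlib

open MeasureTheory Real Set

/-- The generalized Mittag-Leffler function `E_{α,β}(x) = ∑_{k=0}^∞ x^k / Γ(αk+β)`. -/
noncomputable def mittagLeffler (α β x : ℝ) : ℝ :=
  ∑' k : ℕ, x ^ k / Real.Gamma (α * k + β)

/-- The density on `(0, ct)` of the distance process `R_d^{2,j}` of the random flight
`Z_d^{2,j}` with a fractional-Poisson number of changes of direction. -/
noncomputable def distDensity (d : ℕ) (c t lam r : ℝ) : ℝ :=
  (2 * Real.pi ^ ((d : ℝ) / 2) / Real.Gamma ((d : ℝ) / 2)) * r ^ (d - 1) *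
    (lam * t * (c ^ 2 * t ^ 2 - r ^ 2) ^ ((d : ℝ) / 2 - 2) /
      (Real.pi ^ ((d : ℝ) / 2) * (c * t) ^ (2 * (d - 2)))) *
    (mittagLeffler ((d : ℝ) / 2 - 1) ((d : ℝ) / 2 - 1)
        (lam * t * (c ^ 2 * t ^ 2 - r ^ 2) ^ ((d : ℝ) / 2 - 1) / (c * t) ^ (d - 2)) /
      mittagLeffler ((d : ℝ) / 2 - 1) ((d : ℝ) / 2) (lam * t))

theorem gamma_lower (M y : ℝ) (hM : 0 < M) (hy : 1 ≤ y) :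
    M ^ (y - 1) * Real.exp (-M) ≤ Real.Gamma y := by
  have hconv := Real.GammaIntegral_convergent (s := y) (by linarith)
  rw [Real.Gamma_eq_integral (by linarith), ← integral_exp_neg_Ioi, ← integral_const_mul]
  have hi : IntegrableOn (fun x : ℝ => Real.exp (-x)) (Ioi M) := by
    simpa using integrableOn_exp_neg_Ioi M
  calc _ ≤ ∫ x in Ioi M, Real.exp (-x) * x ^ (y - 1) := by
        apply setIntegral_mono_on (hi.const_mul _)
          (hconv.mono_set (Ioi_subset_Ioi hM.le)) measurableSet_Ioi
        intro x hx
        rw [mul_comm]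
        have hx' : M < x := hx
        have : M ^ (y - 1) ≤ x ^ (y - 1) :=
          Real.rpow_le_rpow hM.le hx'.le (by linarith)
        gcongr
    _ ≤ _ := by
        apply setIntegral_mono_set hconv _ (Ioi_subset_Ioi hM.le).eventuallyLE
        filter_upwards [ae_restrict_mem measurableSet_Ioi] with x hx
        have hx' : (0 : ℝ) < x := hx
        simp only [Pi.zero_apply]
        positivity

theorem ml_summable (α β x : ℝ) (hα : 0 < α) (hβ : 0 < β) (hx : 0 ≤ x) :
    Summable (fun k : ℕ => x ^ k / Real.Gamma (α * k + β)) := by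
  obtain ⟨M, hM0, hM⟩ : ∃ M : ℝ, 0 < M ∧ M ^ α = 2 * x + 1 := by
    refine ⟨(2 * x + 1) ^ (1 / α), by positivity, ?_⟩
    rw [← Real.rpow_mul (by positivity), one_div_mul_cancel hα.ne', Real.rpow_one]
  have hr : x / (2 * x + 1) < 1 := by
    rw [div_lt_one (by positivity)]; linarith
  have hg := (summable_geometric_of_lt_one (by positivity) hr).mul_left
    ((M ^ (β - 1) * Real.exp (-M))⁻¹)
  obtain ⟨N, hN⟩ := exists_nat_gt (1 / α)
  rw [← summable_nat_add_iff N] at hg ⊢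
  refine Summable.of_nonneg_of_le (fun k => ?_) (fun k => ?_) hg
  · have : 0 < Real.Gamma (α * (k + N : ℕ) + β) := Real.Gamma_pos_of_pos (by positivity)
    positivity
  · have h1 : 1 ≤ α * (k + N : ℕ) + β := by
      rw [div_lt_iff₀ hα] at hN
      push_cast
      have : 0 ≤ α * k := by positivity
      nlinarith
    have h2 := gamma_lower M _ hM0 h1
    have h3 : M ^ (α * (k + N : ℕ) + β - 1) = (2 * x + 1) ^ (k + N) * M ^ (β - 1) := by
      rw [add_sub_assoc, Real.rpow_add hM0, Real.rpow_mul hM0.le, hM, Real.rpow_natCast]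
    rw [h3] at h2
    calc x ^ (k + N) / Real.Gamma (α * (k + N : ℕ) + β)
        ≤ x ^ (k + N) / ((2 * x + 1) ^ (k + N) * M ^ (β - 1) * Real.exp (-M)) := by
          gcongr
      _ = _ := by
          rw [div_pow]; field_simp

theorem beta_set (u v : ℝ) (hu : 0 < u) (hv : 0 < v) :
    ∫ x in Ioo (0 : ℝ) 1, x ^ (u - 1) * (1 - x) ^ (v - 1) =
      Real.Gamma u * Real.Gamma v / Real.Gamma (u + v) := by
  have h := ProbabilityTheory.beta_eq_betaIntegralReal u v hu hv
  rw [ProbabilityTheory.beta] at h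
  rw [h, Complex.betaIntegral, intervalIntegral.integral_of_le zero_le_one,
    ← integral_Ioc_eq_integral_Ioo]
  have : ∫ x in Ioc (0 : ℝ) 1, (x : ℂ) ^ ((u : ℂ) - 1) * (1 - (x : ℂ)) ^ ((v : ℂ) - 1) =
      ∫ x in Ioc (0 : ℝ) 1, ((x ^ (u - 1) * (1 - x) ^ (v - 1) : ℝ) : ℂ) := by
    apply setIntegral_congr_fun measurableSet_Ioc
    intro x hx
    simp only
    rw [Complex.ofReal_mul, Complex.ofReal_cpow hx.1.le,
      Complex.ofReal_cpow (by linarith [hx.2])]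
    push_cast
    rfl
  rw [this, integral_complex_ofReal, Complex.ofReal_re]

theorem beta_integrable (u v : ℝ) (hu : 0 < u) (hv : 0 < v) :
    IntegrableOn (fun x : ℝ => x ^ (u - 1) * (1 - x) ^ (v - 1)) (Ioo (0 : ℝ) 1) := by
  by_contra h
  have h1 := beta_set u v hu hv
  rw [integral_undef h] at h1
  have := Real.Gamma_pos_of_pos hu
  have := Real.Gamma_pos_of_pos hv
  have := Real.Gamma_pos_of_pos (add_pos hu hv)
  have : 0 < Real.Gamma u * Real.Gamma v / Real.Gamma (u + v) := by positivity
  linarith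

theorem core_int (α u z : ℝ) (hα : 0 < α) (hu : 0 < u) (hz : 0 ≤ z) :
    ∫ x in Ioo (0 : ℝ) 1, x ^ (u - 1) * (1 - x) ^ (α - 1) *
      mittagLeffler α α (z * (1 - x) ^ α) = Real.Gamma u * mittagLeffler α (α + u) z := by
  set F : ℕ → ℝ → ℝ := fun k x =>
    z ^ k / Real.Gamma (α * k + α) * (x ^ (u - 1) * (1 - x) ^ ((α * k + α) - 1)) with hF
  have hpos : ∀ k : ℕ, 0 < α * k + α := fun k => by positivity
  have hGp : ∀ k : ℕ, 0 < Real.Gamma (α * k + α) := fun k => Real.Gamma_pos_of_pos (hpos k)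
  have hint : ∀ k, IntegrableOn (F k) (Ioo (0 : ℝ) 1) := fun k =>
    (beta_integrable u _ hu (hpos k)).const_mul _
  have hval : ∀ k, ∫ x in Ioo (0 : ℝ) 1, F k x =
      Real.Gamma u * (z ^ k / Real.Gamma (α * k + (α + u))) := fun k => by
    simp only [hF]
    rw [integral_const_mul, beta_set u _ hu (hpos k)]
    have h1 := (hGp k).ne'
    have h2 : Real.Gamma (α * k + (α + u)) ≠ 0 :=
      (Real.Gamma_pos_of_pos (by positivity)).ne'
    rw [show u + (α * k + α) = α * k + (α + u) by ring]
    field_simp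
  have hnorm : ∀ k, ∫ x in Ioo (0 : ℝ) 1, ‖F k x‖ = ∫ x in Ioo (0 : ℝ) 1, F k x := fun k => by
    apply setIntegral_congr_fun measurableSet_Ioo
    intro x hx
    have h1 := hGp k
    have h2 := hx.1
    have h3 : 0 < 1 - x := by linarith [hx.2]
    simp only [hF]
    exact Real.norm_of_nonneg (by positivity)
  have hs := hasSum_integral_of_summable_integral_norm (F := F) hint (by
    simp only [hnorm, hval]
    exact (ml_summable α (α + u) z hα (by positivity) hz).mul_left _)
  have h4 := hs.tsum_eq
  simp only [hval] at h4
  rw [tsum_mul_left] at h4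
  rw [mittagLeffler, h4]
  apply setIntegral_congr_fun measurableSet_Ioo
  intro x hx
  have h3 : 0 < 1 - x := by linarith [hx.2]
  simp only [mittagLeffler, hF]
  rw [← tsum_mul_left]
  congr 1
  ext k
  rw [mul_pow, ← Real.rpow_natCast ((1 - x) ^ α) k, ← Real.rpow_mul h3.le,
    show α * k + α - 1 = (α - 1) + α * k by ring, Real.rpow_add h3]
  ring

theorem sq_sub (g : ℝ → ℝ) :
    ∫ x in Ioo (0 : ℝ) 1, g x = ∫ s in Ioo (0 : ℝ) 1, 2 * s * g (s ^ 2) := by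
  have him : (fun s : ℝ => s ^ 2) '' Ioo (0 : ℝ) 1 = Ioo 0 1 := by
    ext x
    constructor
    · rintro ⟨s, hs, rfl⟩
      exact ⟨by have := hs.1; positivity, by have := hs.1; have := hs.2; simp only; nlinarith⟩
    · intro hx
      refine ⟨Real.sqrt x, ⟨Real.sqrt_pos.2 hx.1, ?_⟩, Real.sq_sqrt hx.1.le⟩
      rw [Real.sqrt_lt' one_pos]; simpa using hx.2
  have h := integral_image_eq_integral_abs_deriv_smul (f := fun s : ℝ => s ^ 2)
    (f' := fun s => 2 * s) (s := Ioo (0 : ℝ) 1) measurableSet_Ioo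
    (fun x _ => by simpa using (hasDerivAt_pow 2 x).hasDerivWithinAt)
    (fun x hx y hy hxy => by
      have h1 := hx.1
      have h2 := hy.1
      exact (sq_eq_sq₀ h1.le h2.le).1 hxy) g
  rw [him] at h
  rw [h]
  apply setIntegral_congr_fun measurableSet_Ioo
  intro s hs
  have := hs.1
  simp only [smul_eq_mul]
  rw [abs_of_pos (by linarith)]

theorem dens_scaled (d : ℕ) (hd : 3 ≤ d) (c t lam p s : ℝ)
    (hc : 0 < c) (ht : 0 < t) (hs : s ∈ Ioo (0 : ℝ) 1) :
    (c * t) * ((c * t * s) ^ p * distDensity d c t lam (c * t * s)) =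
      (c * t) ^ p * (lam * t) / (Real.Gamma ((d : ℝ) / 2) *
        mittagLeffler ((d : ℝ) / 2 - 1) ((d : ℝ) / 2) (lam * t)) *
      (2 * s * ((s ^ 2) ^ ((p + d) / 2 - 1) * (1 - s ^ 2) ^ ((d : ℝ) / 2 - 1 - 1) *
        mittagLeffler ((d : ℝ) / 2 - 1) ((d : ℝ) / 2 - 1)
          (lam * t * (1 - s ^ 2) ^ ((d : ℝ) / 2 - 1)))) := by
  obtain ⟨n, rfl⟩ : ∃ n, d = n + 3 := ⟨d - 3, by omega⟩
  have ha : 0 < c * t := mul_pos hc ht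
  have hs0 := hs.1
  have hs1 : 0 < 1 - s ^ 2 := by nlinarith [hs.1, hs.2]
  unfold distDensity
  rw [show n + 3 - 1 = n + 2 by omega, show n + 3 - 2 = n + 1 by omega,
    show c ^ 2 * t ^ 2 - (c * t * s) ^ 2 = (c * t) ^ 2 * (1 - s ^ 2) by ring]
  generalize c * t = a at *
  have e1 : (a ^ 2) ^ (((n + 3 : ℕ) : ℝ) / 2 - 1) = a ^ (n + 1) := by
    rw [← Real.rpow_natCast a 2, ← Real.rpow_mul ha.le, ← Real.rpow_natCast]
    congr 1; push_cast; ring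
  have e2 : (a ^ 2) ^ (((n + 3 : ℕ) : ℝ) / 2 - 2) = a ^ (n + 1) / a ^ 2 := by
    rw [show ((n + 3 : ℕ) : ℝ) / 2 - 2 = (((n + 3 : ℕ) : ℝ) / 2 - 1) - 1 by ring,
      Real.rpow_sub (by positivity), e1, Real.rpow_one]
  have e3 : (s ^ 2) ^ ((p + (n + 3 : ℕ)) / 2 - 1) = s ^ p * s ^ (n + 1) := by
    rw [← Real.rpow_natCast s 2, ← Real.rpow_mul hs0.le, ← Real.rpow_natCast,
      ← Real.rpow_add hs0]
    congr 1; push_cast; ring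
  have e4 : lam * t * (a ^ (n + 1) * (1 - s ^ 2) ^ (((n + 3 : ℕ) : ℝ) / 2 - 1)) / a ^ (n + 1) =
      lam * t * (1 - s ^ 2) ^ (((n + 3 : ℕ) : ℝ) / 2 - 1) := by
    field_simp
  rw [Real.mul_rpow (by positivity) hs1.le, Real.mul_rpow (by positivity) hs1.le, e1, e2, e3, e4,
    Real.mul_rpow ha.le hs0.le,
    show ((n + 3 : ℕ) : ℝ) / 2 - 1 - 1 = ((n + 3 : ℕ) : ℝ) / 2 - 2 by ring]
  generalize mittagLeffler _ _ _ = A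
  generalize mittagLeffler _ _ _ = B
  have hpi : (0 : ℝ) < Real.pi ^ (((n + 3 : ℕ) : ℝ) / 2) := by positivity
  generalize Real.pi ^ (((n + 3 : ℕ) : ℝ) / 2) = P at *
  generalize (1 - s ^ 2) ^ (((n + 3 : ℕ) : ℝ) / 2 - 2) = Q
  generalize Real.Gamma _ = G
  generalize s ^ p = S
  generalize a ^ p = T
  simp only [div_eq_mul_inv, mul_inv]
  generalize B⁻¹ = B'
  generalize G⁻¹ = G'
  field_simp
  ring

theorem moment_distance_process (d : ℕ) (hd : 3 ≤ d) (c t lam p : ℝ)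
    (hc : 0 < c) (ht : 0 < t) (hlam : 0 < lam) (hp : 1 ≤ p) :
    (∫ r in (0 : ℝ)..(c * t), r ^ p * distDensity d c t lam r) +
        (c * t) ^ p /
          (mittagLeffler ((d : ℝ) / 2 - 1) ((d : ℝ) / 2) (lam * t) * Real.Gamma ((d : ℝ) / 2)) =
      (c * t) ^ p / mittagLeffler ((d : ℝ) / 2 - 1) ((d : ℝ) / 2) (lam * t) *
        (Real.Gamma ((p + (d : ℝ)) / 2) / Real.Gamma ((d : ℝ) / 2) * (lam * t) *
            mittagLeffler ((d : ℝ) / 2 - 1) ((d : ℝ) + p / 2 - 1) (lam * t) +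
          1 / Real.Gamma ((d : ℝ) / 2)) := by
  have hd' : (3 : ℝ) ≤ d := by exact_mod_cast hd
  have h0 := intervalIntegral.mul_integral_comp_mul_left (a := 0) (b := 1)
    (f := fun r => r ^ p * distDensity d c t lam r) (c * t)
  rw [mul_zero, mul_one] at h0
  have hcore := core_int ((d : ℝ) / 2 - 1) ((p + d) / 2) (lam * t) (by linarith) (by linarith)
    (by positivity)
  rw [sq_sub] at hcore
  rw [← h0, ← intervalIntegral.integral_const_mul,
    intervalIntegral.integral_of_le zero_le_one, integral_Ioc_eq_integral_Ioo,
    setIntegral_congr_fun measurableSet_Ioo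
      (fun s hs => dens_scaled d hd c t lam p s hc ht hs),
    integral_const_mul, hcore,
    show (d : ℝ) / 2 - 1 + (p + d) / 2 = (d : ℝ) + p / 2 - 1 by ring]
  simp only [div_eq_mul_inv, mul_inv]
  ring
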